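/- arXiv:1603.09657 — 2 statements merged into one kernel-verified Lean document; each statement's English description precedes it below -/
import Mathlib

section
/- Let Ω, γ, α, L be as in the setup and assume the interior Green identity. Then for every function φ : ℝ² → ℂ² that is C² on an open neighborhood of the closure of Ω and satisfies the infinite-mass boundary condition φ₂(γ(s)) = i e^{iα(s)} φ₁(γ(s)) for all s ∈ [0,L], one has ∫_Ω |Tφ(x)|² dx = ∫_Ω |∇φ(x)|² dx + (1/2) ∫₀^L α'(s) |φ(γ(s))|²_{ℂ²} ds. -/
open MeasureTheory

/-- first partial derivative of a complex-valued function on ℝ². -/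
noncomputable def d1 (f : ℝ × ℝ → ℂ) (x : ℝ × ℝ) : ℂ := fderiv ℝ f x (1, 0)

/-- second partial derivative of a complex-valued function on ℝ². -/
noncomputable def d2 (f : ℝ × ℝ → ℂ) (x : ℝ × ℝ) : ℂ := fderiv ℝ f x (0, 1)

/-- massless Dirac expression `T = (1/i)(σ₁ ∂₁ + σ₂ ∂₂)`, written componentwise:
`(Tφ)₁ = -i(∂₁ - i∂₂)φ₂` and `(Tφ)₂ = -i(∂₁ + i∂₂)φ₁`. -/
noncomputable def diracT (φ : ℝ × ℝ → ℂ × ℂ) (x : ℝ × ℝ) : ℂ × ℂ :=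
  (-Complex.I * d1 (fun y => (φ y).2) x - d2 (fun y => (φ y).2) x,
   -Complex.I * d1 (fun y => (φ y).1) x + d2 (fun y => (φ y).1) x)

/-- `|∇φ|² = Σ_{j=1,2} (|∂_jφ₁|² + |∂_jφ₂|²)`. -/
noncomputable def gradSq (φ : ℝ × ℝ → ℂ × ℂ) (x : ℝ × ℝ) : ℝ :=
  ‖d1 (fun y => (φ y).1) x‖ ^ 2 + ‖d1 (fun y => (φ y).2) x‖ ^ 2 +
    ‖d2 (fun y => (φ y).1) x‖ ^ 2 + ‖d2 (fun y => (φ y).2) x‖ ^ 2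

/-- squared Euclidean norm on ℂ². -/
noncomputable def normSq2 (v : ℂ × ℂ) : ℝ := ‖v.1‖ ^ 2 + ‖v.2‖ ^ 2

open scoped ComplexConjugate

lemma contDiffOn_d1 {f : ℝ × ℝ → ℂ} {V : Set (ℝ × ℝ)} (hV : IsOpen V)
    (hf : ContDiffOn ℝ 2 f V) : ContDiffOn ℝ 1 (d1 f) V :=
  (hf.fderiv_of_isOpen hV (m := 1) (by norm_num)).clm_apply contDiffOn_const

lemma contDiffOn_d2 {f : ℝ × ℝ → ℂ} {V : Set (ℝ × ℝ)} (hV : IsOpen V)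
    (hf : ContDiffOn ℝ 2 f V) : ContDiffOn ℝ 1 (d2 f) V :=
  (hf.fderiv_of_isOpen hV (m := 1) (by norm_num)).clm_apply contDiffOn_const

lemma d1_d2_comm {f : ℝ × ℝ → ℂ} {x : ℝ × ℝ} (hf : ContDiffAt ℝ 2 f x) :
    d1 (d2 f) x = d2 (d1 f) x := by
  have hd : DifferentiableAt ℝ (fderiv ℝ f) x :=
    (hf.fderiv_right (m := 1) (by norm_num)).differentiableAt (by norm_num)
  have hsymm := (hf.isSymmSndFDerivAt (by simp)).eq (1, 0) (0, 1)
  have key (w z : ℝ × ℝ) :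
      fderiv ℝ (fun y => fderiv ℝ f y w) x z = fderiv ℝ (fderiv ℝ f) x z w := by
    rw [fderiv_clm_apply hd (differentiableAt_const w)]
    simp
  change fderiv ℝ (fun y => fderiv ℝ f y (0, 1)) x (1, 0) =
    fderiv ℝ (fun y => fderiv ℝ f y (1, 0)) x (0, 1)
  rw [key, key, hsymm]

lemma contDiffOn_mul_conj {f g : ℝ × ℝ → ℂ} {V : Set (ℝ × ℝ)} {n : WithTop ℕ∞}
    (hf : ContDiffOn ℝ n f V) (hg : ContDiffOn ℝ n g V) :
    ContDiffOn ℝ n (fun y => f y * conj (g y)) V :=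
  hf.mul (Complex.conjCLE.contDiff.comp_contDiffOn hg)

lemma hasFDerivAt_conj {g : ℝ × ℝ → ℂ} {x : ℝ × ℝ} (hg : DifferentiableAt ℝ g x) :
    HasFDerivAt (fun y => conj (g y)) ((Complex.conjCLE : ℂ →L[ℝ] ℂ).comp (fderiv ℝ g x)) x :=
  Complex.conjCLE.hasFDerivAt.comp x hg.hasFDerivAt

lemma fderiv_mul_conj_sub {f g h k : ℝ × ℝ → ℂ} {x : ℝ × ℝ} (hf : DifferentiableAt ℝ f x)
    (hg : DifferentiableAt ℝ g x) (hh : DifferentiableAt ℝ h x) (hk : DifferentiableAt ℝ k x)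
    (w : ℝ × ℝ) :
    fderiv ℝ (fun y => f y * conj (g y) - h y * conj (k y)) x w =
      (fderiv ℝ f x w * conj (g x) + f x * conj (fderiv ℝ g x w)) -
        (fderiv ℝ h x w * conj (k x) + h x * conj (fderiv ℝ k x w)) := by
  have key := (hf.hasFDerivAt.mul (hasFDerivAt_conj hg)).sub
    (hh.hasFDerivAt.mul (hasFDerivAt_conj hk))
  have e : fderiv ℝ (fun y => f y * conj (g y) - h y * conj (k y)) x = _ := key.fderiv
  rw [e]
  simp
  ring

/-- The divergence of the field `(u ∂₂ū - v ∂₂v̄, v ∂₁v̄ - u ∂₁ū)`, where `φ = (u, v)`,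
is `i (|Tφ|² - |∇φ|²)`. -/
lemma div_current_eq {φ : ℝ × ℝ → ℂ × ℂ} {x : ℝ × ℝ} {u v : ℝ × ℝ → ℂ}
    (hu : ContDiffAt ℝ 2 u x) (hv : ContDiffAt ℝ 2 v x)
    (hφ : φ = fun y => (u y, v y))
    (hu1 : DifferentiableAt ℝ (d1 u) x) (hu2 : DifferentiableAt ℝ (d2 u) x)
    (hv1 : DifferentiableAt ℝ (d1 v) x) (hv2 : DifferentiableAt ℝ (d2 v) x) :
    d1 (fun y => u y * conj (d2 u y) - v y * conj (d2 v y)) x +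
        d2 (fun y => v y * conj (d1 v y) - u y * conj (d1 u y)) x =
      Complex.I * ((normSq2 (diracT φ x) - gradSq φ x : ℝ) : ℂ) := by
  have hu0 := hu.differentiableAt (by norm_num)
  have hv0 := hv.differentiableAt (by norm_num)
  have e1 := fderiv_mul_conj_sub hu0 hu2 hv0 hv2 (1, 0)
  have e2 := fderiv_mul_conj_sub hv0 hv1 hu0 hu1 (0, 1)
  have cu := d1_d2_comm hu
  have cv := d1_d2_comm hv
  subst hφ
  simp only [normSq2, diracT, gradSq]
  simp only [d1, d2] at *
  rw [e1, e2, cu, cv]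
  generalize fderiv ℝ u x (1, 0) = a
  generalize fderiv ℝ u x (0, 1) = b
  generalize fderiv ℝ v x (1, 0) = c
  generalize fderiv ℝ v x (0, 1) = d
  simp only [Complex.sq_norm, Complex.normSq_apply]
  apply Complex.ext <;> simp <;> ring

/-- If `q = i e^{iα} p` near `s`, then `p p̄' - q q̄' = i α' (|p|² + |q|²) / 2` at `s`. -/
lemma mul_conj_deriv_sub_of_phase {p q : ℝ → ℂ} {α : ℝ → ℝ} {s a : ℝ} {p' q' : ℂ}
    (hp : HasDerivAt p p' s) (hq : HasDerivAt q q' s) (hα : HasDerivAt α a s)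
    (hpq : q =ᶠ[nhds s] fun t => Complex.I * Complex.exp (Complex.I * (α t : ℂ)) * p t) :
    p s * conj p' - q s * conj q' =
      Complex.I * ((a * (1 / 2 * (‖p s‖ ^ 2 + ‖q s‖ ^ 2)) : ℝ) : ℂ) := by
  have hq2 := ((((hα.ofReal_comp.const_mul Complex.I).cexp).const_mul Complex.I).mul
    hp).congr_of_eventuallyEq hpq
  have e := hq.unique hq2
  have e0 := hpq.self_of_nhds
  simp only at e0
  have hE : Complex.exp (Complex.I * (α s : ℂ)) *
      conj (Complex.exp (Complex.I * (α s : ℂ))) = 1 := by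
    rw [← Complex.exp_conj, ← Complex.exp_add]
    simp
  have hn : ‖q s‖ ^ 2 = ‖p s‖ ^ 2 := by
    rw [e0, mul_comm Complex.I (α s : ℂ)]
    simp [Complex.norm_exp_ofReal_mul_I]
  rw [hn, e, e0]
  have hpp : ((‖p s‖ ^ 2 : ℝ) : ℂ) = p s * conj (p s) := by
    rw [Complex.mul_conj, Complex.normSq_eq_norm_sq]
  have ha : ((a * (1 / 2 * (‖p s‖ ^ 2 + ‖p s‖ ^ 2)) : ℝ) : ℂ) = a * (p s * conj (p s)) := by
    rw [← hpp]
    push_cast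
    ring
  rw [ha]
  generalize Complex.exp (Complex.I * (α s : ℂ)) = E at hE ⊢
  simp only [map_add, map_mul, Complex.conj_I, Complex.conj_ofReal]
  linear_combination (Complex.I ^ 2 * p s * (conj p' - Complex.I * a * conj (p s))) * hE
   + (p s * conj p' - Complex.I * a * p s * conj (p s)) * Complex.I_sq

theorem energy_identity_H_infinity
    (Ω : Set (ℝ × ℝ)) (hΩopen : IsOpen Ω) (hΩbdd : Bornology.IsBounded Ω)
    (hΩconn : IsConnected Ω)
    (L : ℝ) (hL : 0 < L)
    (γ : ℝ → ℝ × ℝ) (α : ℝ → ℝ)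
    (hγC : ContDiff ℝ 3 γ) (hαC : ContDiff ℝ 2 α)
    (hper : ∀ s, γ (s + L) = γ s)
    (hinj : Set.InjOn γ (Set.Ico 0 L))
    (hbdry : frontier Ω = γ '' Set.Icc 0 L)
    (hγ' : ∀ s, deriv γ s = (-Real.sin (α s), Real.cos (α s)))
    -- interior Green identity, componentwise for complex vector fields
    (hGreen : ∀ F : ℝ × ℝ → ℂ × ℂ, ∀ U : Set (ℝ × ℝ), IsOpen U → closure Ω ⊆ U →
      ContDiffOn ℝ 1 F U →
      (∫ x in Ω, (d1 (fun y => (F y).1) x + d2 (fun y => (F y).2) x)) =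
        ∫ s in (0:ℝ)..L,
          ((F (γ s)).1 * (Real.cos (α s) : ℂ) + (F (γ s)).2 * (Real.sin (α s) : ℂ)))
    (φ : ℝ × ℝ → ℂ × ℂ)
    (V : Set (ℝ × ℝ)) (hVopen : IsOpen V) (hVΩ : closure Ω ⊆ V)
    (hφ : ContDiffOn ℝ 2 φ V)
    -- infinite mass boundary condition φ₂(γ(s)) = i e^{iα(s)} φ₁(γ(s))
    (hbc : ∀ s ∈ Set.Icc (0:ℝ) L,
      (φ (γ s)).2 = Complex.I * Complex.exp (Complex.I * (α s : ℂ)) * (φ (γ s)).1) :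
    (∫ x in Ω, normSq2 (diracT φ x)) =
      (∫ x in Ω, gradSq φ x) +
        (1 / 2) * ∫ s in (0:ℝ)..L, deriv α s * normSq2 (φ (γ s)) := by
  set u : ℝ × ℝ → ℂ := fun y => (φ y).1 with hu_def
  set v : ℝ × ℝ → ℂ := fun y => (φ y).2 with hv_def
  have hu : ContDiffOn ℝ 2 u V := hφ.fst
  have hv : ContDiffOn ℝ 2 v V := hφ.snd
  have hu1 := contDiffOn_d1 hVopen hu
  have hu2 := contDiffOn_d2 hVopen hu
  have hv1 := contDiffOn_d1 hVopen hv
  have hv2 := contDiffOn_d2 hVopen hv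
  have hu' := hu.of_le (m := 1) (by norm_num)
  have hv' := hv.of_le (m := 1) (by norm_num)
  have hcpt : IsCompact (closure Ω) := hΩbdd.isCompact_closure
  have hint {g : ℝ × ℝ → ℝ} (hg : ContinuousOn g V) : IntegrableOn g Ω :=
    ((hg.mono hVΩ).integrableOn_compact hcpt).mono_set subset_closure
  have c1 := hu1.continuousOn
  have c2 := hu2.continuousOn
  have c3 := hv1.continuousOn
  have c4 := hv2.continuousOn
  have hT : IntegrableOn (fun x => normSq2 (diracT φ x)) Ω := by
    apply hint
    change ContinuousOn (fun x => ‖-Complex.I * d1 v x - d2 v x‖ ^ 2 +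
      ‖-Complex.I * d1 u x + d2 u x‖ ^ 2) V
    fun_prop
  have hG : IntegrableOn (fun x => gradSq φ x) Ω := by
    apply hint
    change ContinuousOn (fun x => ‖d1 u x‖ ^ 2 + ‖d1 v x‖ ^ 2 + ‖d2 u x‖ ^ 2 + ‖d2 v x‖ ^ 2) V
    fun_prop
  have green := hGreen (fun y => (u y * conj (d2 u y) - v y * conj (d2 v y),
      v y * conj (d1 v y) - u y * conj (d1 u y))) V hVopen hVΩ
    (((contDiffOn_mul_conj hu' hu2).sub (contDiffOn_mul_conj hv' hv2)).prodMk
      ((contDiffOn_mul_conj hv' hv1).sub (contDiffOn_mul_conj hu' hu1)))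
  have hbulk : (∫ x in Ω, (d1 (fun y => u y * conj (d2 u y) - v y * conj (d2 v y)) x +
        d2 (fun y => v y * conj (d1 v y) - u y * conj (d1 u y)) x)) =
      Complex.I * (((∫ x in Ω, normSq2 (diracT φ x)) - ∫ x in Ω, gradSq φ x : ℝ) : ℂ) := by
    rw [← integral_sub hT hG, ← integral_complex_ofReal, ← integral_const_mul]
    refine setIntegral_congr_fun hΩopen.measurableSet fun x hx => ?_
    have hxV := hVopen.mem_nhds (hVΩ (subset_closure hx))
    exact div_current_eq (hu.contDiffAt hxV) (hv.contDiffAt hxV) rfl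
      ((hu1.contDiffAt hxV).differentiableAt (by norm_num))
      ((hu2.contDiffAt hxV).differentiableAt (by norm_num))
      ((hv1.contDiffAt hxV).differentiableAt (by norm_num))
      ((hv2.contDiffAt hxV).differentiableAt (by norm_num))
  have hbdryInt : (∫ s in (0:ℝ)..L,
      ((u (γ s) * conj (d2 u (γ s)) - v (γ s) * conj (d2 v (γ s))) * (Real.cos (α s) : ℂ) +
        (v (γ s) * conj (d1 v (γ s)) - u (γ s) * conj (d1 u (γ s))) * (Real.sin (α s) : ℂ))) =
      Complex.I * (((1 / 2) * ∫ s in (0:ℝ)..L, deriv α s * normSq2 (φ (γ s)) : ℝ) : ℂ) := by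
    rw [← intervalIntegral.integral_const_mul, ← intervalIntegral.integral_ofReal,
      ← intervalIntegral.integral_const_mul]
    refine intervalIntegral.integral_congr_ae ?_
    have hne : ∀ᵐ s : ℝ, s ≠ L := by simp [ae_iff]
    filter_upwards [hne] with s hsL hs
    rw [Set.uIoc_of_le hL.le] at hs
    have hs' : s ∈ Set.Ioo 0 L := ⟨hs.1, lt_of_le_of_ne hs.2 hsL⟩
    have hxV : V ∈ nhds (γ s) := hVopen.mem_nhds <| hVΩ <| frontier_subset_closure <| by
      rw [hbdry]
      exact ⟨s, Set.Ioo_subset_Icc_self hs', rfl⟩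
    have hγs : HasDerivAt γ (-Real.sin (α s), Real.cos (α s)) s :=
      hγ' s ▸ (hγC.differentiable (by norm_num) s).hasDerivAt
    have chain {f : ℝ × ℝ → ℂ} (hf : ContDiffOn ℝ 2 f V) : HasDerivAt (fun t => f (γ t))
        (d2 f (γ s) * (Real.cos (α s) : ℂ) - d1 f (γ s) * (Real.sin (α s) : ℂ)) s := by
      have h := (((hf.contDiffAt hxV).differentiableAt
        (by norm_num)).hasFDerivAt).comp_hasDerivAt s hγs
      refine h.congr_deriv ?_
      have hvec : (-Real.sin (α s), Real.cos (α s)) =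
          (-Real.sin (α s)) • ((1, 0) : ℝ × ℝ) + Real.cos (α s) • ((0, 1) : ℝ × ℝ) := by
        simp
      rw [hvec, map_add, map_smul, map_smul]
      simp only [d1, d2, Complex.real_smul]
      push_cast
      ring
    have key := mul_conj_deriv_sub_of_phase (chain hu) (chain hv)
      (hαC.differentiable (by norm_num) s).hasDerivAt
      (by
        filter_upwards [Ioo_mem_nhds hs'.1 hs'.2] with t ht
        exact hbc t (Set.Ioo_subset_Icc_self ht))
    have hN : (1 / 2) * (deriv α s * normSq2 (φ (γ s))) =
        deriv α s * (1 / 2 * (‖u (γ s)‖ ^ 2 + ‖v (γ s)‖ ^ 2)) := by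
      simp only [normSq2, hu_def, hv_def]
      ring
    rw [hN, ← key]
    simp only [map_sub, map_mul, Complex.conj_ofReal]
    ring
  rw [hbulk, hbdryInt] at green
  have := Complex.ofReal_injective (mul_left_cancel₀ Complex.I_ne_zero green)
  linarith
end

section
/- Let δ > 0, k > 0, and let f : [0,δ] → ℝ be continuously differentiable with f(δ) = 0. Then ∫₀^δ (f'(t)² + k² f(t)²) dt ≥ k f(0)² (e^{kδ} + e^{−kδ})/(e^{kδ} − e^{−kδ}); in particular ∫₀^δ (f'(t)² + k² f(t)²) dt ≥ k f(0)². -/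
open MeasureTheory intervalIntegral

/-- If `v` is the derivative of `u` and `k² u` that of `v`, then the energy of `f` is bounded below by the
boundary values of the calibration `2 f v - u v`. -/
lemma boundary_term_le_energy {a b k : ℝ} (hab : a ≤ b) {f u v : ℝ → ℝ} (hf : ContDiff ℝ 1 f)
    (hu : ∀ t, HasDerivAt u (v t) t) (hv : ∀ t, HasDerivAt v (k ^ 2 * u t) t) :
    (2 * f b * v b - u b * v b) - (2 * f a * v a - u a * v a) ≤
      ∫ t in a..b, ((deriv f t) ^ 2 + k ^ 2 * (f t) ^ 2) := by
  have hfc : Continuous f := hf.continuous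
  have hdc : Continuous (deriv f) := hf.continuous_deriv le_rfl
  have huc : Continuous u := continuous_iff_continuousAt.2 fun t => (hu t).continuousAt
  have hvc : Continuous v := continuous_iff_continuousAt.2 fun t => (hv t).continuousAt
  have hG : ∀ t, HasDerivAt (fun t => 2 * f t * v t - u t * v t)
      (2 * deriv f t * v t + 2 * f t * (k ^ 2 * u t) - (v t * v t + u t * (k ^ 2 * u t))) t := by
    intro t
    have hft := (hf.differentiable one_ne_zero t).hasDerivAt
    exact ((hft.const_mul 2).mul (hv t)).sub ((hu t).mul (hv t))
  have hint : IntervalIntegrable (fun t => 2 * deriv f t * v t + 2 * f t * (k ^ 2 * u t) -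
      (v t * v t + u t * (k ^ 2 * u t))) volume a b :=
    Continuous.intervalIntegrable (by fun_prop) _ _
  rw [← integral_eq_sub_of_hasDerivAt (fun t _ => hG t) hint]
  refine integral_mono hab hint (Continuous.intervalIntegrable (by fun_prop) _ _) fun t => ?_
  nlinarith [sq_nonneg (deriv f t - v t), sq_nonneg (k * (f t - u t))]

theorem one_dim_energy_sharp_lower_bound
    (δ k : ℝ) (hδ : 0 < δ) (hk : 0 < k)
    (f : ℝ → ℝ) (hf : ContDiff ℝ 1 f) (hfδ : f δ = 0) :
    (∫ t in (0:ℝ)..δ, ((deriv f t) ^ 2 + k ^ 2 * (f t) ^ 2)) ≥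
        k * (f 0) ^ 2 * (Real.exp (k * δ) + Real.exp (-(k * δ))) /
          (Real.exp (k * δ) - Real.exp (-(k * δ))) ∧
      (∫ t in (0:ℝ)..δ, ((deriv f t) ^ 2 + k ^ 2 * (f t) ^ 2)) ≥ k * (f 0) ^ 2 := by
  have hkδ : 0 < k * δ := mul_pos hk hδ
  have hden : 0 < Real.exp (k * δ) - Real.exp (-(k * δ)) :=
    sub_pos.2 (Real.exp_lt_exp.2 (by linarith))
  have sharp : k * (f 0) ^ 2 * (Real.exp (k * δ) + Real.exp (-(k * δ))) /
      (Real.exp (k * δ) - Real.exp (-(k * δ))) ≤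
      ∫ t in (0:ℝ)..δ, ((deriv f t) ^ 2 + k ^ 2 * (f t) ^ 2) := by
    set c : ℝ := f 0 / (Real.exp (k * δ) - Real.exp (-(k * δ))) with hc
    have hlin : ∀ t, HasDerivAt (fun t : ℝ => k * (δ - t)) (-k) t := fun t => by
      simpa using ((hasDerivAt_id t).const_sub δ).const_mul k
    have hu : ∀ t, HasDerivAt
        (fun t => c * (Real.exp (k * (δ - t)) - Real.exp (-(k * (δ - t)))))
        (-(k * c) * (Real.exp (k * (δ - t)) + Real.exp (-(k * (δ - t))))) t := fun t => by
      exact (((hlin t).exp.sub (hlin t).neg.exp).const_mul c).congr_deriv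
        (by simp only [Pi.neg_apply]; ring)
    have hv : ∀ t, HasDerivAt
        (fun t => -(k * c) * (Real.exp (k * (δ - t)) + Real.exp (-(k * (δ - t)))))
        (k ^ 2 * (c * (Real.exp (k * (δ - t)) - Real.exp (-(k * (δ - t)))))) t := fun t => by
      exact (((hlin t).exp.add (hlin t).neg.exp).const_mul (-(k * c))).congr_deriv
        (by simp only [Pi.neg_apply]; ring)
    refine le_trans (le_of_eq ?_) (boundary_term_le_energy hδ.le hf hu hv)
    simp only [hfδ, sub_self, sub_zero, mul_zero, neg_zero, zero_mul, zero_sub]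
    rw [hc]
    field_simp
    ring
  refine ⟨sharp, le_trans ?_ sharp⟩
  rw [le_div_iff₀ hden]
  exact mul_le_mul_of_nonneg_left (by linarith [Real.exp_pos (-(k * δ))]) (by positivity)
end
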